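/- arXiv:1910.07378 — 2 statements merged into one kernel-verified Lean document; each statement's English description precedes it below -/
import Mathlib

section
/- Let P be a T-invariant probability measure on Ω = ((ℝ^d))^ℤ. Then the following are equivalent: (a) P is null-homologous; (b) the family of laws {P ∘ S_n^{-1} : n ≥ 0} on ℝ^d is tight; (c) the family of laws {P ∘ S_{-n}^{-1} : n ≥ 0} on ℝ^d is tight. -/
open MeasureTheory

noncomputable section

abbrev VecD (d : ℕ) := Fin d → ℝ
abbrev SeqD (d : ℕ) := ℤ → VecD d

/-- The left shift on doubly infinite sequences. -/
def shiftT (d : ℕ) : SeqD d → SeqD d := fun x n => x (n + 1)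

/-- The map `D x = T x - x`. -/
def mapD (d : ℕ) : SeqD d → SeqD d := fun x => shiftT d x - x

/-- The partial sums `S_n`. -/
def Spart (d : ℕ) (n : ℤ) (x : SeqD d) : VecD d :=
  if 0 ≤ n then ∑ i ∈ Finset.range n.toNat, x ((i : ℤ) + 1)
  else -∑ i ∈ Finset.range (-n).toNat, x (n + 1 + (i : ℤ))

/-- Tightness of a family of measures. -/
def IsTightFamily {E ι : Type*} [TopologicalSpace E] {m : MeasurableSpace E}
    (μ : ι → Measure E) : Prop :=
  ∀ ε : ℝ, 0 < ε → ∃ K : Set E, IsCompact K ∧ ∀ i, 1 - ENNReal.ofReal ε ≤ μ i K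

/-- A `T`-invariant probability measure is null-homologous if it is the image under `D`
of a `T`-invariant probability measure. -/
def NullHomologous {d : ℕ} (P : Measure (SeqD d)) : Prop :=
  ∃ Q : Measure (SeqD d), IsProbabilityMeasure Q ∧ Q.map (shiftT d) = Q ∧ Q.map (mapD d) = P

/-- The maps `Λ_k`. -/
def Lam (d : ℕ) (k : ℕ) (x : SeqD d) : SeqD d × SeqD d :=
  ((shiftT d)^[k] x, ∑ i ∈ Finset.range k, (shiftT d)^[i] x)

/-- The map `S (x, y) = (T x, x + y)`. -/
def SMap (d : ℕ) : SeqD d × SeqD d → SeqD d × SeqD d := fun p => (shiftT d p.1, p.1 + p.2)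

open Filter Topology
open scoped ENNReal NNReal BoundedContinuousFunction

section Tightness

/-- For probability measures on a Hausdorff space, `IsTightFamily` is tightness of the range. -/
lemma isTightFamily_iff_isTightMeasureSet_range {E ι : Type*} [TopologicalSpace E] [T2Space E]
    [MeasurableSpace E] [OpensMeasurableSpace E] {μ : ι → Measure E}
    (hμ : ∀ i, IsProbabilityMeasure (μ i)) :
    IsTightFamily μ ↔ IsTightMeasureSet (Set.range μ) := by
  rw [isTightMeasureSet_iff_exists_isCompact_measure_compl_le]
  simp only [Set.forall_mem_range]
  constructor
  · intro h ε hε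
    obtain ⟨δ, hδ, hδε⟩ : ∃ δ : ℝ, 0 < δ ∧ ENNReal.ofReal δ ≤ ε := by
      obtain ⟨δ, hδ, hδε⟩ := ENNReal.lt_iff_exists_nnreal_btwn.1 hε
      exact ⟨δ, by exact_mod_cast hδ, by simpa using hδε.le⟩
    obtain ⟨K, hK, hKμ⟩ := h δ hδ
    refine ⟨K, hK, fun i => ?_⟩
    rw [prob_compl_eq_one_sub hK.measurableSet]
    exact (tsub_le_iff_tsub_le.1 (hKμ i)).trans hδε
  · intro h ε hε
    obtain ⟨K, hK, hKμ⟩ := h (ENNReal.ofReal ε) (by simpa using hε)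
    refine ⟨K, hK, fun i => ?_⟩
    have := hKμ i
    rw [prob_compl_eq_one_sub hK.measurableSet] at this
    exact tsub_le_iff_tsub_le.1 this

/-- A set of measures on a countable product is tight as soon as its marginals are. -/
lemma isTightMeasureSet_pi {ι : Type*} [Countable ι] {E : ι → Type*}
    [∀ i, TopologicalSpace (E i)] [∀ i, MeasurableSpace (E i)] {S : Set (Measure (∀ i, E i))}
    (h : ∀ i, IsTightMeasureSet (Measure.map (fun x : ∀ i, E i => x i) '' S)) :
    IsTightMeasureSet S := by
  simp only [isTightMeasureSet_iff_exists_isCompact_measure_compl_le, Set.forall_mem_image] at h ⊢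
  intro ε hε
  obtain ⟨δ, hδ, hsum⟩ := ENNReal.exists_pos_sum_of_countable hε.ne' ι
  choose K hK hKμ using fun i => h i (δ i) (by exact_mod_cast hδ i)
  refine ⟨Set.univ.pi K, isCompact_univ_pi hK, fun μ hμ => ?_⟩
  have hsub : (Set.univ.pi K)ᶜ ⊆ ⋃ i, (fun x : ∀ i, E i => x i) ⁻¹' (K i)ᶜ := by
    intro x hx
    simpa [Set.mem_pi] using hx
  calc μ (Set.univ.pi K)ᶜ
      ≤ ∑' i, μ ((fun x : ∀ i, E i => x i) ⁻¹' (K i)ᶜ) :=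
        (measure_mono hsub).trans (measure_iUnion_le _)
    _ ≤ ∑' i, (δ i : ℝ≥0∞) := ENNReal.tsum_le_tsum fun i =>
        (Measure.le_map_apply (measurable_pi_apply i).aemeasurable _).trans (hKμ i hμ)
    _ ≤ ε := hsum.le

end Tightness

section InvariantMeasure

variable {E : Type*} [MeasurableSpace E]

/-- The average of the first `n + 1` measures of a sequence. -/
def cesaroMeasure (ν : ℕ → Measure E) (n : ℕ) : Measure E :=
  ((n : ℝ≥0∞) + 1)⁻¹ • ∑ k ∈ Finset.range (n + 1), ν k

lemma cesaroMeasure_apply_le {ν : ℕ → Measure E} {s : Set E} {c : ℝ≥0∞} (h : ∀ k, ν k s ≤ c)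
    (n : ℕ) : cesaroMeasure ν n s ≤ c := by
  simp only [cesaroMeasure, Measure.smul_apply, Measure.finsetSum_apply, smul_eq_mul]
  calc ((n : ℝ≥0∞) + 1)⁻¹ * ∑ k ∈ Finset.range (n + 1), ν k s
      ≤ ((n : ℝ≥0∞) + 1)⁻¹ * ∑ k ∈ Finset.range (n + 1), c := by gcongr; exact h _
    _ = (((n : ℝ≥0∞) + 1)⁻¹ * (n + 1)) * c := by simp [mul_assoc]
    _ = c := by rw [ENNReal.inv_mul_cancel (by simp) (by finiteness), one_mul]

lemma isProbabilityMeasure_cesaroMeasure {ν : ℕ → Measure E}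
    (hν : ∀ k, IsProbabilityMeasure (ν k)) (n : ℕ) :
    IsProbabilityMeasure (cesaroMeasure ν n) := by
  constructor
  simp only [cesaroMeasure, Measure.smul_apply, Measure.finsetSum_apply, smul_eq_mul, measure_univ]
  simpa using ENNReal.inv_mul_cancel (a := (n : ℝ≥0∞) + 1) (by simp) (by finiteness)

lemma integral_cesaroMeasure [TopologicalSpace E] [OpensMeasurableSpace E] {ν : ℕ → Measure E}
    (hν : ∀ k, IsProbabilityMeasure (ν k)) (n : ℕ) (f : E →ᵇ ℝ) :
    ∫ x, f x ∂(cesaroMeasure ν n) =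
      ((n : ℝ) + 1)⁻¹ * ∑ k ∈ Finset.range (n + 1), ∫ x, f x ∂(ν k) := by
  rw [cesaroMeasure, integral_smul_measure, integral_finsetSum_measure fun k _ => f.integrable _]
  simp [ENNReal.toReal_add]

/-- **Krylov–Bogolyubov**: if the iterated images of `μ` under a continuous map `T` are tight and
all have the same image `P` under a continuous map `D`, then some `T`-invariant probability
measure has image `P` under `D`. -/
theorem exists_invariant_map_eq_of_isTightMeasureSet_iterate
    [TopologicalSpace E] [T2Space E] [BorelSpace E] [HasOuterApproxClosed E]
    {F : Type*} [MeasurableSpace F] [TopologicalSpace F] [BorelSpace F] [HasOuterApproxClosed F]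
    {T : E → E} (hT : Continuous T) {D : E → F} (hD : Continuous D)
    {μ : Measure E} [IsProbabilityMeasure μ] {P : Measure F} [IsProbabilityMeasure P]
    (htight : IsTightMeasureSet (Set.range fun k => μ.map T^[k]))
    (hP : ∀ k, (μ.map T^[k]).map D = P) :
    ∃ Q : Measure E, IsProbabilityMeasure Q ∧ Q.map T = Q ∧ Q.map D = P := by
  set ν : ℕ → Measure E := fun k => μ.map T^[k] with hν_def
  have hν : ∀ k, IsProbabilityMeasure (ν k) := fun k =>
    Measure.isProbabilityMeasure_map (hT.iterate k).measurable.aemeasurable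
  let R : ℕ → ProbabilityMeasure E := fun n =>
    ⟨cesaroMeasure ν n, isProbabilityMeasure_cesaroMeasure hν n⟩
  have hR : IsCompact (closure (Set.range R)) := by
    apply isCompact_closure_of_isTightMeasureSet
    rw [isTightMeasureSet_iff_exists_isCompact_measure_compl_le] at htight ⊢
    intro ε hε
    obtain ⟨K, hK, hKν⟩ := htight ε hε
    refine ⟨K, hK, ?_⟩
    rintro _ ⟨_, ⟨n, rfl⟩, rfl⟩
    exact cesaroMeasure_apply_le (fun k => hKν _ ⟨k, rfl⟩) n
  obtain ⟨Q, -, hQ⟩ := hR.ultrafilter_le_nhds ((hyperfilter ℕ).map R)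
    (le_principal_iff.2 (Filter.mem_of_superset (Filter.range_mem_map) subset_closure))
  have hlim : ∀ f : E →ᵇ ℝ, Tendsto (fun n => ∫ x, f x ∂(cesaroMeasure ν n))
      (hyperfilter ℕ : Filter ℕ) (𝓝 (∫ x, f x ∂(Q : Measure E))) :=
    ProbabilityMeasure.tendsto_iff_forall_integral_tendsto.1 hQ
  have hle : (hyperfilter ℕ : Filter ℕ) ≤ atTop := Nat.hyperfilter_le_atTop
  refine ⟨Q, inferInstance, ?_, ?_⟩
  · have : IsProbabilityMeasure ((Q : Measure E).map T) :=
      Measure.isProbabilityMeasure_map hT.measurable.aemeasurable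
    refine ext_of_forall_integral_eq_of_IsFiniteMeasure fun f => ?_
    rw [integral_map hT.measurable.aemeasurable f.continuous.aestronglyMeasurable]
    have hlimT := hlim (f.compContinuous ⟨T, hT⟩)
    have hshift : ∀ k, ∫ x, f (T x) ∂(ν k) = ∫ x, f x ∂(ν (k + 1)) := fun k => by
      rw [hν_def]
      simp only [Function.iterate_succ', ← Measure.map_map hT.measurable (hT.iterate k).measurable]
      rw [integral_map hT.measurable.aemeasurable f.continuous.aestronglyMeasurable]
    have hdiff : ∀ n : ℕ, ∫ x, f (T x) ∂(cesaroMeasure ν n) - ∫ x, f x ∂(cesaroMeasure ν n) =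
        ((n : ℝ) + 1)⁻¹ * (∫ x, f x ∂(ν (n + 1)) - ∫ x, f x ∂(ν 0)) := fun n => by
      have := integral_cesaroMeasure hν n (f.compContinuous ⟨T, hT⟩)
      simp only [BoundedContinuousFunction.compContinuous_apply, ContinuousMap.coe_mk,
        hshift] at this
      rw [this, integral_cesaroMeasure hν n f, ← mul_sub, ← Finset.sum_sub_distrib,
        Finset.sum_range_sub fun k => ∫ x, f x ∂(ν k)]
    have hbound : ∀ k, ‖∫ x, f x ∂(ν k)‖ ≤ ‖f‖ := fun k => by
      simpa using f.norm_integral_le_norm (ν k)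
    have hzero : Tendsto (fun n : ℕ => ∫ x, f (T x) ∂(cesaroMeasure ν n) -
        ∫ x, f x ∂(cesaroMeasure ν n)) atTop (𝓝 0) := by
      refine squeeze_zero_norm (a := fun n : ℕ => (1 / ((n : ℝ) + 1)) * (‖f‖ + ‖f‖))
        (fun n => ?_) (by simpa using
          (tendsto_one_div_add_atTop_nhds_zero_nat (𝕜 := ℝ)).mul_const (‖f‖ + ‖f‖))
      rw [hdiff, norm_mul, norm_inv, one_div, Real.norm_of_nonneg (by positivity)]
      gcongr
      exact (norm_sub_le _ _).trans (add_le_add (hbound _) (hbound _))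
    exact sub_eq_zero.1 (tendsto_nhds_unique (hlimT.sub (hlim f)) (hzero.mono_left hle))
  · have : IsProbabilityMeasure ((Q : Measure E).map D) :=
      Measure.isProbabilityMeasure_map hD.measurable.aemeasurable
    refine ext_of_forall_integral_eq_of_IsFiniteMeasure fun f => ?_
    rw [integral_map hD.measurable.aemeasurable f.continuous.aestronglyMeasurable]
    refine tendsto_nhds_unique (hlim (f.compContinuous ⟨D, hD⟩)) ?_
    refine tendsto_const_nhds.congr fun n => ?_
    rw [integral_cesaroMeasure hν]
    have : ∀ k, ∫ x, f (D x) ∂(ν k) = ∫ y, f y ∂P := fun k => by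
      rw [← hP k, integral_map hD.measurable.aemeasurable f.continuous.aestronglyMeasurable]
    simp only [BoundedContinuousFunction.compContinuous_apply, ContinuousMap.coe_mk, this,
      Finset.sum_const, Finset.card_range, nsmul_eq_mul, Nat.cast_add, Nat.cast_one]
    field_simp

end InvariantMeasure

section PartialSums

variable {d : ℕ}

lemma continuous_shiftT : Continuous (shiftT d) := by
  unfold shiftT
  fun_prop

lemma continuous_mapD : Continuous (mapD d) :=
  continuous_shiftT.sub continuous_id

lemma continuous_Spart (n : ℤ) : Continuous (Spart d n) := by
  unfold Spart
  split_ifs <;> fun_prop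

lemma shiftT_iterate_apply (k : ℕ) (x : SeqD d) (n : ℤ) : (shiftT d)^[k] x n = x (n + k) := by
  induction k generalizing x with
  | zero => simp
  | succ k ih =>
    rw [Function.iterate_succ_apply, ih]
    simp only [shiftT]
    congr 1
    push_cast
    ring

lemma Spart_natCast (n : ℕ) (x : SeqD d) :
    Spart d n x = ∑ i ∈ Finset.range n, x ((i : ℤ) + 1) := by
  simp [Spart]

lemma Spart_neg_natCast (n : ℕ) (x : SeqD d) :
    Spart d (-(n : ℤ)) x = -∑ i ∈ Finset.range n, x (-(n : ℤ) + 1 + i) := by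
  rcases n with _ | n
  · simp [Spart]
  · rw [Spart, if_neg (by omega)]
    simp

lemma Spart_sub_Spart_sub_one (n : ℤ) (x : SeqD d) :
    Spart d n x - Spart d (n - 1) x = x n := by
  rcases lt_or_ge 0 n with hn | hn
  · obtain ⟨m, rfl⟩ : ∃ m : ℕ, n = (m + 1 : ℕ) := ⟨(n - 1).toNat, by omega⟩
    rw [show ((m + 1 : ℕ) : ℤ) - 1 = m by push_cast; ring, Spart_natCast, Spart_natCast,
      Finset.sum_range_succ]
    simp
  · obtain ⟨m, rfl⟩ : ∃ m : ℕ, n = -(m : ℤ) := ⟨(-n).toNat, by omega⟩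
    rw [show -(m : ℤ) - 1 = -((m + 1 : ℕ) : ℤ) by push_cast; ring, Spart_neg_natCast,
      Spart_neg_natCast, Finset.sum_range_succ']
    have : ∀ i : ℕ, -((m + 1 : ℕ) : ℤ) + 1 + ((i + 1 : ℕ) : ℤ) = -(m : ℤ) + 1 + i := fun i => by
      push_cast
      ring
    simp only [this]
    simp

lemma Spart_mapD (n : ℕ) (y : SeqD d) : Spart d n (mapD d y) = y (n + 1) - y 1 := by
  rw [Spart_natCast]
  simpa [mapD, shiftT] using Finset.sum_range_sub (fun i : ℕ => y ((i : ℤ) + 1)) n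

lemma Spart_neg_shiftT_iterate (n : ℕ) (x : SeqD d) :
    Spart d (-(n : ℤ)) ((shiftT d)^[n] x) = -Spart d n x := by
  rw [Spart_neg_natCast, Spart_natCast]
  simp only [shiftT_iterate_apply]
  congr 1
  refine Finset.sum_congr rfl fun i _ => ?_
  congr 1
  ring

/-- A primitive of `x` for the difference operator `mapD`. -/
def primitive (d : ℕ) (x : SeqD d) : SeqD d := fun n => Spart d (n - 1) x

lemma continuous_primitive : Continuous (primitive d) :=
  continuous_pi fun n => continuous_Spart (n - 1)

lemma mapD_primitive (x : SeqD d) : mapD d (primitive d x) = x := by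
  ext1 n
  simpa [mapD, shiftT, primitive] using Spart_sub_Spart_sub_one n x

lemma mapD_shiftT_iterate (k : ℕ) (x : SeqD d) :
    mapD d ((shiftT d)^[k] x) = (shiftT d)^[k] (mapD d x) := by
  ext1 n
  simp only [mapD, Pi.sub_apply, shiftT_iterate_apply, shiftT]
  congr 2
  ring

lemma map_shiftT_iterate {P : Measure (SeqD d)} (hT : P.map (shiftT d) = P) (k : ℕ) :
    P.map (shiftT d)^[k] = P :=
  (MeasurePreserving.iterate ⟨continuous_shiftT.measurable, hT⟩ k).map_eq

lemma map_Spart_neg {P : Measure (SeqD d)} (hT : P.map (shiftT d) = P) (n : ℕ) :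
    P.map (Spart d (-(n : ℤ))) = (P.map (Spart d n)).map Neg.neg := by
  conv_lhs => rw [← map_shiftT_iterate hT n]
  rw [Measure.map_map (continuous_Spart _).measurable (continuous_shiftT.iterate n).measurable,
    Measure.map_map measurable_neg (continuous_Spart _).measurable]
  congr 1
  ext1 x
  exact Spart_neg_shiftT_iterate n x

lemma isTightMeasureSet_range_map_Spart_neg_iff {P : Measure (SeqD d)}
    (hT : P.map (shiftT d) = P) :
    IsTightMeasureSet (Set.range fun n : ℕ => P.map (Spart d n)) ↔
      IsTightMeasureSet (Set.range fun n : ℕ => P.map (Spart d (-(n : ℤ)))) := by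
  constructor <;> intro h <;> refine (h.map continuous_neg).subset ?_ <;> rintro _ ⟨n, rfl⟩
  · exact ⟨_, ⟨n, rfl⟩, (map_Spart_neg hT n).symm⟩
  · refine ⟨_, ⟨n, rfl⟩, ?_⟩
    simp only [map_Spart_neg hT]
    rw [Measure.map_map measurable_neg measurable_neg]
    simp

lemma NullHomologous.isTightMeasureSet_range_map_Spart {P : Measure (SeqD d)}
    (h : NullHomologous P) :
    IsTightMeasureSet (Set.range fun n : ℕ => P.map (Spart d n)) := by
  obtain ⟨Q, _, hQT, rfl⟩ := h
  have hmarg : ∀ k : ℕ, Q.map (fun y : SeqD d => y k) = Q.map (fun y : SeqD d => y 0) := by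
    intro k
    conv_rhs => rw [← map_shiftT_iterate hQT k]
    rw [Measure.map_map (by fun_prop) (continuous_shiftT.iterate k).measurable]
    congr 1
    ext1 y
    simp [shiftT_iterate_apply]
  have hpair : IsTightMeasureSet
      (Set.range fun n : ℕ => Q.map fun y : SeqD d => (y ((n : ℤ) + 1), y 1)) := by
    have hsing : IsTightMeasureSet {Q.map (fun y : SeqD d => y 0)} := by
      have : IsProbabilityMeasure (Q.map (fun y : SeqD d => y 0)) :=
        Measure.isProbabilityMeasure_map (measurable_pi_apply 0).aemeasurable
      exact isTightMeasureSet_singleton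
    refine IsTightMeasureSet.prodMk (hsing.subset ?_) (hsing.subset ?_)
    · rintro _ ⟨_, ⟨n, rfl⟩, rfl⟩
      rw [Set.mem_singleton_iff, ← hmarg (n + 1)]
      rw [Measure.fst_map_prodMk (by fun_prop)]
      simp
    · rintro _ ⟨_, ⟨n, rfl⟩, rfl⟩
      rw [Set.mem_singleton_iff, ← hmarg 1]
      rw [Measure.snd_map_prodMk (by fun_prop)]
      simp
  refine (hpair.map (f := fun p : VecD d × VecD d => p.1 - p.2) (by fun_prop)).subset ?_
  rintro _ ⟨n, rfl⟩
  refine ⟨_, ⟨n, rfl⟩, ?_⟩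
  simp only
  rw [Measure.map_map (by fun_prop) (by fun_prop),
    Measure.map_map (continuous_Spart _).measurable continuous_mapD.measurable]
  congr 1
  ext1 y
  exact (Spart_mapD n y).symm

lemma nullHomologous_of_isTightMeasureSet {P : Measure (SeqD d)} [IsProbabilityMeasure P]
    (hT : P.map (shiftT d) = P)
    (h : IsTightMeasureSet (Set.range fun n : ℕ => P.map (Spart d n))) :
    NullHomologous P := by
  have hall : IsTightMeasureSet (Set.range fun n : ℤ => P.map (Spart d n)) := by
    refine (h.union ((isTightMeasureSet_range_map_Spart_neg_iff hT).1 h)).subset ?_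
    rintro _ ⟨n, rfl⟩
    obtain ⟨m, rfl | rfl⟩ := n.eq_nat_or_neg
    exacts [Or.inl ⟨m, rfl⟩, Or.inr ⟨m, rfl⟩]
  have hprim : Measurable (primitive d) := continuous_primitive.measurable
  have hiter : ∀ k, Measurable (shiftT d)^[k] := fun k => (continuous_shiftT.iterate k).measurable
  have : IsProbabilityMeasure (P.map (primitive d)) :=
    Measure.isProbabilityMeasure_map hprim.aemeasurable
  refine exists_invariant_map_eq_of_isTightMeasureSet_iterate (μ := P.map (primitive d))
    continuous_shiftT continuous_mapD (isTightMeasureSet_pi fun n => hall.subset ?_) fun k => ?_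
  · rintro _ ⟨_, ⟨k, rfl⟩, rfl⟩
    refine ⟨n + k - 1, ?_⟩
    simp only
    rw [Measure.map_map (hiter k) hprim, Measure.map_map (by fun_prop) ((hiter k).comp hprim)]
    congr 1
    ext1 x
    simp [shiftT_iterate_apply, primitive]
  · rw [Measure.map_map (hiter k) hprim,
      Measure.map_map continuous_mapD.measurable ((hiter k).comp hprim)]
    conv_rhs => rw [← map_shiftT_iterate hT k]
    congr 1
    ext1 x
    simp [mapD_shiftT_iterate, mapD_primitive]

end PartialSums

/-- Theorem (main result): for a `T`-invariant probability measure `P` on `Ω = (ℝ^d)^ℤ`,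
the following are equivalent: (a) `P` is null-homologous; (b) the family of laws of `S_n`,
`n ≥ 0`, is tight; (c) the family of laws of `S_{-n}`, `n ≥ 0`, is tight. -/
theorem main_result (d : ℕ) (hd : 1 ≤ d) (P : Measure (SeqD d)) [IsProbabilityMeasure P]
    (hT : P.map (shiftT d) = P) :
    (NullHomologous P ↔ IsTightFamily (fun n : ℕ => P.map (Spart d n))) ∧
    (IsTightFamily (fun n : ℕ => P.map (Spart d n)) ↔
      IsTightFamily (fun n : ℕ => P.map (Spart d (-(n : ℤ))))) := by
  have hprob : ∀ n : ℤ, IsProbabilityMeasure (P.map (Spart d n)) := fun n =>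
    Measure.isProbabilityMeasure_map (continuous_Spart n).measurable.aemeasurable
  rw [isTightFamily_iff_isTightMeasureSet_range fun n : ℕ => hprob n,
    isTightFamily_iff_isTightMeasureSet_range fun n : ℕ => hprob (-(n : ℤ))]
  exact ⟨⟨NullHomologous.isTightMeasureSet_range_map_Spart,
    nullHomologous_of_isTightMeasureSet hT⟩, isTightMeasureSet_range_map_Spart_neg_iff hT⟩
end
end

section
/- Let P be a T-invariant probability measure on Ω = ((ℝ^d))^ℤ such that the family of laws {P ∘ S_n^{-1} : n ≥ 0} on ℝ^d is tight. Then the family of pushforward measures {P ∘ Λ_k^{-1} : k ∈ ℕ} on Ω × Ω is tight (for every ε > 0 there is a compact subset of Ω × Ω whose measure under every P ∘ Λ_k^{-1} is at least 1 − ε). -/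
open MeasureTheory

noncomputable section

open ENNReal

lemma measurable_shiftT (d : ℕ) : Measurable (shiftT d) := by
  unfold shiftT
  fun_prop

lemma iterate_shiftT_apply (d k : ℕ) (x : SeqD d) (n : ℤ) :
    (shiftT d)^[k] x n = x (n + k) := by
  induction k generalizing x with
  | zero => simp
  | succ k ih =>
    rw [Function.iterate_succ_apply, ih]
    simp only [shiftT]
    congr 1
    push_cast
    ring

lemma measurable_Lam (d k : ℕ) : Measurable (Lam d k) := by
  have h (i : ℕ) : Measurable ((shiftT d)^[i]) := (measurable_shiftT d).iterate i
  unfold Lam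
  fun_prop

/-- The sums over any window of length `k` all have the law of `S_k`. -/
lemma map_window_sum_eq {d : ℕ} {P : Measure (SeqD d)} (hT : P.map (shiftT d) = P)
    (k : ℕ) (n : ℤ) :
    P.map (fun x => ∑ i ∈ Finset.range k, x (n + i)) = P.map (Spart d k) := by
  have hS : Spart d k = fun x => ∑ i ∈ Finset.range k, x (1 + (i : ℤ)) := by
    funext x
    simp [Spart, add_comm]
  have hstep (n : ℤ) : P.map (fun x => ∑ i ∈ Finset.range k, x (n + 1 + (i : ℤ)))
      = P.map (fun x => ∑ i ∈ Finset.range k, x (n + (i : ℤ))) := by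
    conv_rhs => rw [← hT]
    rw [Measure.map_map (by fun_prop) (measurable_shiftT d)]
    congr 1
    funext x
    simp only [Function.comp_apply, shiftT]
    exact Finset.sum_congr rfl fun i _ => by congr 1; ring
  rw [hS]
  induction n using Int.inductionOn' (b := 1) with
  | zero => rfl
  | succ n _ ih => rw [hstep, ih]
  | pred n _ ih => rw [← ih, ← hstep (n - 1), sub_add_cancel]

lemma isTightFamily_iff_measure_compl_le {E ι : Type*} [TopologicalSpace E] [T2Space E]
    {m : MeasurableSpace E} [OpensMeasurableSpace E] {μ : ι → Measure E}
    (hμ : ∀ i, IsProbabilityMeasure (μ i)) :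
    IsTightFamily μ ↔
      ∀ ε : ℝ, 0 < ε → ∃ K : Set E, IsCompact K ∧ ∀ i, μ i Kᶜ ≤ ENNReal.ofReal ε := by
  refine forall₂_congr fun ε _ => exists_congr fun K => and_congr_right fun hK =>
    forall_congr' fun i => ?_
  have := hμ i
  rw [prob_compl_eq_one_sub hK.measurableSet, tsub_le_iff_tsub_le]

/-- A family of laws on a countable product is tight if each of its marginals is tight. -/
lemma IsTightFamily.pi {α ι E : Type*} [Countable α] [TopologicalSpace E] [T2Space E]
    [SecondCountableTopology E] [MeasurableSpace E] [BorelSpace E]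
    {μ : ι → Measure (α → E)} (hμ : ∀ i, IsProbabilityMeasure (μ i))
    (h : ∀ a, IsTightFamily fun i => (μ i).map (fun x => x a)) : IsTightFamily μ := by
  have hμ' (a : α) (i : ι) : IsProbabilityMeasure ((μ i).map (fun x => x a)) :=
    Measure.isProbabilityMeasure_map (measurable_pi_apply a).aemeasurable
  rw [isTightFamily_iff_measure_compl_le hμ]
  intro ε hε
  obtain ⟨δ, hδ, hsum⟩ := ENNReal.exists_pos_sum_of_countable
    (ENNReal.ofReal_pos.2 hε).ne' α
  choose K hK hle using fun a =>
    (isTightFamily_iff_measure_compl_le (hμ' a)).1 (h a) (δ a) (hδ a)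
  refine ⟨Set.univ.pi K, isCompact_univ_pi hK, fun i => ?_⟩
  calc μ i (Set.univ.pi K)ᶜ
      = μ i (⋃ a, (fun x => x a) ⁻¹' (K a)ᶜ) := by
        congr 1
        ext x
        simp
    _ ≤ ∑' a, μ i ((fun x => x a) ⁻¹' (K a)ᶜ) := measure_iUnion_le _
    _ ≤ ∑' a, (δ a : ℝ≥0∞) := ENNReal.tsum_le_tsum fun a => by
        rw [← Measure.map_apply (by fun_prop) (hK a).measurableSet.compl]
        simpa using hle a i
    _ ≤ ENNReal.ofReal ε := hsum.le

/-- A family of laws on a product of two spaces is tight if both of its marginals are. -/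
lemma IsTightFamily.prod {ι E F : Type*} [TopologicalSpace E] [T2Space E]
    [SecondCountableTopology E] [MeasurableSpace E] [BorelSpace E]
    [TopologicalSpace F] [T2Space F]
    [SecondCountableTopology F] [MeasurableSpace F] [BorelSpace F]
    {μ : ι → Measure (E × F)} (hμ : ∀ i, IsProbabilityMeasure (μ i))
    (h₁ : IsTightFamily fun i => (μ i).map Prod.fst)
    (h₂ : IsTightFamily fun i => (μ i).map Prod.snd) : IsTightFamily μ := by
  rw [isTightFamily_iff_measure_compl_le
    fun i => Measure.isProbabilityMeasure_map (by fun_prop)] at h₁ h₂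
  rw [isTightFamily_iff_measure_compl_le hμ]
  intro ε hε
  obtain ⟨K, hK, hKle⟩ := h₁ (ε / 2) (half_pos hε)
  obtain ⟨L, hL, hLle⟩ := h₂ (ε / 2) (half_pos hε)
  refine ⟨K ×ˢ L, hK.prod hL, fun i => ?_⟩
  have hKi := hKle i
  have hLi := hLle i
  rw [Measure.map_apply (by fun_prop) hK.measurableSet.compl] at hKi
  rw [Measure.map_apply (by fun_prop) hL.measurableSet.compl] at hLi
  calc μ i (K ×ˢ L)ᶜ
      = μ i (Prod.fst ⁻¹' Kᶜ ∪ Prod.snd ⁻¹' Lᶜ) := by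
        rw [Set.prod_eq, Set.compl_inter]
        rfl
    _ ≤ μ i (Prod.fst ⁻¹' Kᶜ) + μ i (Prod.snd ⁻¹' Lᶜ) := measure_union_le _ _
    _ ≤ ENNReal.ofReal (ε / 2) + ENNReal.ofReal (ε / 2) := add_le_add hKi hLi
    _ = ENNReal.ofReal ε := by
        rw [← ENNReal.ofReal_add (half_pos hε).le (half_pos hε).le, add_halves]

/-- If the family of laws of `S_n`, `n ≥ 0`, under a `T`-invariant probability measure `P`
is tight, then the family of pushforwards `{P ∘ Λ_k⁻¹ : k ∈ ℕ}` on `Ω × Ω` is tight. -/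
theorem lam_family_tight (d : ℕ) (hd : 1 ≤ d) (P : Measure (SeqD d))
    [IsProbabilityMeasure P] (hT : P.map (shiftT d) = P)
    (htight : IsTightFamily (fun n : ℕ => P.map (Spart d n))) :
    IsTightFamily (fun k : ℕ => P.map (Lam d k)) := by
  have hLam (k : ℕ) : IsProbabilityMeasure (P.map (Lam d k)) :=
    Measure.isProbabilityMeasure_map (measurable_Lam d k).aemeasurable
  refine IsTightFamily.prod hLam
    (IsTightFamily.pi (fun k => Measure.isProbabilityMeasure_map (by fun_prop)) fun n => ?_)
    (IsTightFamily.pi (fun k => Measure.isProbabilityMeasure_map (by fun_prop)) fun n => ?_)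
  · intro ε hε
    obtain ⟨K, hK, hle⟩ := htight ε hε
    refine ⟨K, hK, fun k => (hle 1).trans_eq ?_⟩
    beta_reduce
    rw [Measure.map_map (by fun_prop) (by fun_prop),
      Measure.map_map (by fun_prop) (measurable_Lam d k), ← map_window_sum_eq hT 1 (n + k)]
    congr 2
    funext x
    simp [Lam, iterate_shiftT_apply]
  · intro ε hε
    obtain ⟨K, hK, hle⟩ := htight ε hε
    refine ⟨K, hK, fun k => (hle k).trans_eq ?_⟩
    beta_reduce
    rw [Measure.map_map (by fun_prop) (by fun_prop),
      Measure.map_map (by fun_prop) (measurable_Lam d k), ← map_window_sum_eq hT k n]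
    congr 2
    funext x
    simp [Lam, iterate_shiftT_apply]
end
end
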